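/- No isolation: let n ≥ 2, d ≥ 2, and let 𝒳 denote either the set of fully separable states or the set of biseparable states on (ℂ^d)^{⊗n}. For any pure state ψ₁ on (ℂ^d)^{⊗n} with ψ₁ ∉ 𝒳, there exist a pure state ψ₂ ∉ 𝒳 on (ℂ^d)^{⊗n} with R_𝒳(ψ₂) ≠ R_𝒳(ψ₁) (so ψ₂ is inequivalent to ψ₁), and a CPTP 𝒳-preserving map Λ such that Λ(ψ₁) = ψ₂. -/

import Mathlib

open Matrix Finset
open scoped ComplexOrder

attribute [local instance] Classical.propDecidable

noncomputable section

/-- The rank-one matrix `|v⟩⟨v|` associated to a vector `v`. -/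
def vecProj {D : Type*} [Fintype D] (v : D → ℂ) : Matrix D D ℂ :=
  Matrix.of fun i j => v i * star (v j)

/-- `v` is a unit vector. -/
def UnitVec {D : Type*} [Fintype D] (v : D → ℂ) : Prop :=
  ∑ i, star (v i) * v i = 1

/-- A quantum state: positive semidefinite matrix of trace one. -/
def IsState {D : Type*} [Fintype D] [DecidableEq D] (ρ : Matrix D D ℂ) : Prop :=
  ρ.PosSemidef ∧ ρ.trace = 1

/-- A vector on a multipartite system is fully product if it is a tensor product of
single-party vectors. -/
def IsProdVec {ι : Type*} [Fintype ι] {Idx : ι → Type*} (v : (∀ i, Idx i) → ℂ) : Prop :=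
  ∃ ψ : ∀ i, Idx i → ℂ, ∀ f, v f = ∏ i, ψ i (f i)

/-- A vector on a multipartite system is biseparable if it is a product across some
bipartition of the parties into a nonempty proper subset `M` and its complement. -/
def IsBisepVec {ι : Type*} [Fintype ι] {Idx : ι → Type*} (v : (∀ i, Idx i) → ℂ) : Prop :=
  ∃ M : Finset ι, M.Nonempty ∧ M ≠ Finset.univ ∧
    ∃ (a : ((j : {j : ι // j ∈ M}) → Idx j.1) → ℂ)
      (b : ((j : {j : ι // j ∉ M}) → Idx j.1) → ℂ),
      ∀ f, v f = a (fun j => f j.1) * b (fun j => f j.1)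

/-- Fully separable states: finite convex combinations of fully product pure states. -/
def FullySepState {ι : Type*} [Fintype ι] [DecidableEq ι] (Idx : ι → Type*)
    [∀ i, Fintype (Idx i)] (ρ : Matrix (∀ i, Idx i) (∀ i, Idx i) ℂ) : Prop :=
  ∃ (m : ℕ) (w : Fin m → ℝ) (u : Fin m → (∀ i, Idx i) → ℂ),
    (∀ k, 0 ≤ w k) ∧ (∑ k, w k = 1) ∧
    (∀ k, UnitVec (u k) ∧ IsProdVec (u k)) ∧
    ρ = ∑ k, (w k : ℂ) • vecProj (u k)

/-- Biseparable states: finite convex combinations of biseparable pure states. -/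
def BisepState {ι : Type*} [Fintype ι] [DecidableEq ι] (Idx : ι → Type*)
    [∀ i, Fintype (Idx i)] (ρ : Matrix (∀ i, Idx i) (∀ i, Idx i) ℂ) : Prop :=
  ∃ (m : ℕ) (w : Fin m → ℝ) (u : Fin m → (∀ i, Idx i) → ℂ),
    (∀ k, 0 ≤ w k) ∧ (∑ k, w k = 1) ∧
    (∀ k, UnitVec (u k) ∧ IsBisepVec (u k)) ∧
    ρ = ∑ k, (w k : ℂ) • vecProj (u k)

/-- Completely positive, trace non-increasing map, given by a finite Kraus decomposition
with `∑ Kᵢ† Kᵢ ≤ 𝟙`. -/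
def IsCPTNI {D : Type*} [Fintype D] [DecidableEq D]
    (Λ : Matrix D D ℂ → Matrix D D ℂ) : Prop :=
  ∃ (m : ℕ) (K : Fin m → Matrix D D ℂ),
    (∀ ρ, Λ ρ = ∑ i, K i * ρ * (K i)ᴴ) ∧
    ((1 : Matrix D D ℂ) - ∑ i, (K i)ᴴ * K i).PosSemidef

/-- Completely positive trace preserving map, given by a finite Kraus decomposition
with `∑ Kᵢ† Kᵢ = 𝟙`. -/
def IsCPTP {D : Type*} [Fintype D] [DecidableEq D]
    (Λ : Matrix D D ℂ → Matrix D D ℂ) : Prop :=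
  ∃ (m : ℕ) (K : Fin m → Matrix D D ℂ),
    (∀ ρ, Λ ρ = ∑ i, K i * ρ * (K i)ᴴ) ∧
    (∑ i, (K i)ᴴ * K i = 1)

/-- `Λ` preserves the set `S` of states: for every state `σ ∈ S` with `tr Λ(σ) ≠ 0`,
the normalised output lies in `S`. -/
def PreservesSet {D : Type*} [Fintype D] [DecidableEq D]
    (Λ : Matrix D D ℂ → Matrix D D ℂ) (S : Set (Matrix D D ℂ)) : Prop :=
  ∀ σ, IsState σ → σ ∈ S → (Λ σ).trace ≠ 0 → ((Λ σ).trace)⁻¹ • Λ σ ∈ S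

/-- Robustness of `ρ` relative to the set `S`: the least `s ≥ 0` such that mixing `ρ`
with some state `σ ∈ S` with weight `s` (normalised) lands in `S`. -/
def Robustness {D : Type*} [Fintype D] [DecidableEq D]
    (S : Set (Matrix D D ℂ)) (ρ : Matrix D D ℂ) : ℝ :=
  sInf {s : ℝ | 0 ≤ s ∧ ∃ σ, IsState σ ∧ σ ∈ S ∧
    (((1 + s)⁻¹ : ℝ) : ℂ) • (ρ + (s : ℂ) • σ) ∈ S}

/-- Finite convex combinations of unit vectors with property `P`. -/
def Hull {D : Type*} [Fintype D] (P : (D → ℂ) → Prop) (ρ : Matrix D D ℂ) : Prop :=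
  ∃ (m : ℕ) (w : Fin m → ℝ) (u : Fin m → D → ℂ),
    (∀ k, 0 ≤ w k) ∧ (∑ k, w k = 1) ∧
    (∀ k, UnitVec (u k) ∧ P (u k)) ∧
    ρ = ∑ k, (w k : ℂ) • vecProj (u k)

section gen
variable {D : Type*} [Fintype D]

lemma hull_of_fintype {P : (D → ℂ) → Prop} {ρ : Matrix D D ℂ} {κ : Type*} [Fintype κ]
    (w : κ → ℝ) (u : κ → D → ℂ) (hw : ∀ k, 0 ≤ w k) (h1 : ∑ k, w k = 1)
    (hu : ∀ k, UnitVec (u k) ∧ P (u k)) (hρ : ρ = ∑ k, (w k : ℂ) • vecProj (u k)) :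
    Hull P ρ := by
  let e := (Fintype.equivFin κ).symm
  refine ⟨Fintype.card κ, fun k => w (e k), fun k => u (e k), fun k => hw _, ?_,
    fun k => hu _, ?_⟩
  · rw [← h1]; exact Equiv.sum_comp e w
  · rw [hρ]; exact (Equiv.sum_comp e (fun k => (w k : ℂ) • vecProj (u k))).symm

lemma hull_vec {P : (D → ℂ) → Prop} {u : D → ℂ} (h : UnitVec u) (hP : P u) :
    Hull P (vecProj u) :=
  hull_of_fintype (κ := Unit) (fun _ => 1) (fun _ => u) (by simp) (by simp)
    (fun _ => ⟨h, hP⟩) (by simp)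

lemma hull_convex {P : (D → ℂ) → Prop} {ρ σ : Matrix D D ℂ} (hρ : Hull P ρ) (hσ : Hull P σ)
    (x y : ℝ) (hx : 0 ≤ x) (hy : 0 ≤ y) (hxy : x + y = 1) :
    Hull P ((x : ℂ) • ρ + (y : ℂ) • σ) := by
  obtain ⟨m, w, u, hw, h1, hu, rfl⟩ := hρ
  obtain ⟨m', w', u', hw', h1', hu', rfl⟩ := hσ
  refine hull_of_fintype (κ := Fin m ⊕ Fin m') (Sum.elim (fun k => x * w k) (fun k => y * w' k))
    (Sum.elim u u') ?_ ?_ ?_ ?_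
  · rintro (k | k)
    · exact mul_nonneg hx (hw k)
    · exact mul_nonneg hy (hw' k)
  · simp [Fintype.sum_sum_type, ← Finset.mul_sum, h1, h1', hxy]
  · rintro (k | k)
    · exact hu k
    · exact hu' k
  · simp [Fintype.sum_sum_type, Finset.smul_sum, smul_smul]

/-- The expectation of `ρ` in the vector `v`. -/
def expv (v : D → ℂ) (ρ : Matrix D D ℂ) : ℂ := star v ⬝ᵥ (ρ *ᵥ v)

lemma vecProj_eq (v : D → ℂ) : vecProj v = vecMulVec v (star v) := by
  ext i j; simp [vecProj, vecMulVec_apply]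

lemma unitVec_iff (v : D → ℂ) : UnitVec v ↔ star v ⬝ᵥ v = 1 := by
  simp [UnitVec, dotProduct]

lemma expv_vecProj (v u : D → ℂ) :
    expv v (vecProj u) = (Complex.normSq (star v ⬝ᵥ u) : ℂ) := by
  rw [expv, vecProj_eq, vecMulVec_mulVec, Complex.normSq_eq_conj_mul_self]
  have : (starRingEnd ℂ) (star v ⬝ᵥ u) = star u ⬝ᵥ v := by
    have := star_dotProduct_star v (star u)
    rw [star_star] at this
    rw [starRingEnd_apply, this, star_star]
  rw [this]
  simp [dotProduct_smul, mul_comm]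

lemma expv_add (v : D → ℂ) (ρ σ : Matrix D D ℂ) : expv v (ρ + σ) = expv v ρ + expv v σ := by
  simp [expv, add_mulVec]

lemma expv_smul (v : D → ℂ) (c : ℂ) (ρ : Matrix D D ℂ) : expv v (c • ρ) = c * expv v ρ := by
  simp [expv, smul_mulVec]

lemma expv_sum (v : D → ℂ) {κ : Type*} (s : Finset κ) (ρ : κ → Matrix D D ℂ) :
    expv v (∑ k ∈ s, ρ k) = ∑ k ∈ s, expv v (ρ k) := by
  simp [expv, sum_mulVec, dotProduct_sum]

lemma trace_vecProj (v : D → ℂ) (h : UnitVec v) : (vecProj v).trace = 1 := by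
  rw [← h]; simp [Matrix.trace, vecProj, mul_comm]

lemma posSemidef_vecProj (v : D → ℂ) : (vecProj v).PosSemidef := by
  rw [vecProj_eq]; exact posSemidef_vecMulVec_self_star v

lemma hull_isState [DecidableEq D] {P : (D → ℂ) → Prop} {ρ : Matrix D D ℂ} (h : Hull P ρ) :
    IsState ρ := by
  obtain ⟨m, w, u, hw, h1, hu, rfl⟩ := h
  constructor
  · refine posSemidef_sum _ fun k _ => ?_
    exact (posSemidef_vecProj _).smul (by exact_mod_cast hw k)
  · rw [trace_sum]
    simp only [trace_smul, trace_vecProj _ (hu _).1, smul_eq_mul, mul_one]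
    exact_mod_cast h1

lemma hull_expv {P : (D → ℂ) → Prop} {ρ : Matrix D D ℂ} (h : Hull P ρ) (v : D → ℂ) (lam : ℝ)
    (hl : ∀ u, UnitVec u → P u → Complex.normSq (star v ⬝ᵥ u) ≤ lam) :
    ∃ p : ℝ, expv v ρ = p ∧ 0 ≤ p ∧ p ≤ lam := by
  obtain ⟨m, w, u, hw, h1, hu, rfl⟩ := h
  refine ⟨∑ k, w k * Complex.normSq (star v ⬝ᵥ u k), ?_, ?_, ?_⟩
  · rw [expv_sum]; simp only [expv_smul, expv_vecProj]; push_cast; rfl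
  · exact Finset.sum_nonneg fun k _ => mul_nonneg (hw k) (Complex.normSq_nonneg _)
  · calc _ ≤ ∑ k, w k * lam := Finset.sum_le_sum fun k _ =>
          mul_le_mul_of_nonneg_left (hl _ (hu k).1 (hu k).2) (hw k)
      _ = lam := by rw [← Finset.sum_mul, h1, one_mul]

lemma isCompact_unit : IsCompact {u : D → ℂ | UnitVec u} := by
  refine Metric.isCompact_of_isClosed_isBounded ?_ ?_
  · refine isClosed_eq ?_ continuous_const
    fun_prop
  · refine (Metric.isBounded_closedBall (x := (0 : D → ℂ)) (r := 1)).subset fun u hu => ?_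
    rw [mem_closedBall_zero_iff, pi_norm_le_iff_of_nonneg zero_le_one]
    intro i
    have hu' : ∑ i, Complex.normSq (u i) = 1 := by
      have : ((∑ i, Complex.normSq (u i) : ℝ) : ℂ) = 1 := by
        rw [← (show _ = _ from hu)]
        push_cast
        exact Finset.sum_congr rfl fun i _ => Complex.normSq_eq_conj_mul_self
      exact_mod_cast this
    have := Finset.single_le_sum (f := fun i => Complex.normSq (u i))
      (fun i _ => Complex.normSq_nonneg _) (Finset.mem_univ i)
    rw [hu'] at this
    simp only [Complex.normSq_eq_norm_sq] at this
    nlinarith [norm_nonneg (u i)]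

lemma overlap_identity (v u : D → ℂ) (hv : UnitVec v) (hu : UnitVec u) :
    ∑ i, Complex.normSq (u i - (star v ⬝ᵥ u) * v i) = 1 - Complex.normSq (star v ⬝ᵥ u) := by
  set c := star v ⬝ᵥ u with hc
  have hvu : star u ⬝ᵥ v = star c := by
    have := star_dotProduct_star v (star u)
    rw [star_star] at this
    rw [hc, this, star_star]
  have h : ((∑ i, Complex.normSq (u i - c * v i) : ℝ) : ℂ)
      = star (u - c • v) ⬝ᵥ (u - c • v) := by
    push_cast
    simp only [dotProduct]
    exact Finset.sum_congr rfl fun i _ => by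
      rw [Complex.normSq_eq_conj_mul_self]; simp
  have h2 : star (u - c • v) ⬝ᵥ (u - c • v) = 1 - (Complex.normSq c : ℂ) := by
    rw [unitVec_iff] at hu hv
    simp only [star_sub, star_smul, sub_dotProduct, dotProduct_sub, smul_dotProduct,
      dotProduct_smul, hu, hv, hvu, ← hc, Complex.normSq_eq_conj_mul_self, smul_eq_mul,
      starRingEnd_apply]
    ring
  rw [h2] at h
  exact_mod_cast h

lemma gap {P : (D → ℂ) → Prop} (hcl : IsClosed {u : D → ℂ | UnitVec u ∧ P u})
    (v : D → ℂ) (hv : UnitVec v) (hne : ∀ (c : ℂ) u, UnitVec u → P u → u ≠ c • v) :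
    ∃ lam : ℝ, 0 < lam ∧ lam < 1 ∧
      ∀ u, UnitVec u → P u → Complex.normSq (star v ⬝ᵥ u) ≤ lam := by
  have hcomp : IsCompact {u : D → ℂ | UnitVec u ∧ P u} :=
    isCompact_unit.of_isClosed_subset hcl fun u hu => hu.1
  by_cases hem : {u : D → ℂ | UnitVec u ∧ P u}.Nonempty
  · have hcont : Continuous fun u : D → ℂ => Complex.normSq (star v ⬝ᵥ u) := by
      refine Complex.continuous_normSq.comp ?_
      exact continuous_const.dotProduct continuous_id
    obtain ⟨u, hu, hmax⟩ := hcomp.exists_isMaxOn hem hcont.continuousOn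
    have hlt : Complex.normSq (star v ⬝ᵥ u) < 1 := by
      have hid := overlap_identity v u hv hu.1
      by_contra hcon
      have h0 : ∑ i, Complex.normSq (u i - (star v ⬝ᵥ u) * v i) = 0 :=
        le_antisymm (by linarith) (Finset.sum_nonneg fun i _ => Complex.normSq_nonneg _)
      rw [Finset.sum_eq_zero_iff_of_nonneg fun i _ => Complex.normSq_nonneg _] at h0
      refine hne (star v ⬝ᵥ u) u hu.1 hu.2 ?_
      ext i
      have := h0 i (Finset.mem_univ i)
      rw [Complex.normSq_eq_zero, sub_eq_zero] at this
      simpa using this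
    refine ⟨max (1/2) (Complex.normSq (star v ⬝ᵥ u)), by positivity,
      max_lt (by norm_num) hlt, fun u' h1 h2 => le_max_of_le_right (hmax ⟨h1, h2⟩)⟩
  · refine ⟨1/2, by norm_num, by norm_num, fun u h1 h2 => (hem ⟨u, h1, h2⟩).elim⟩

lemma robust_lower [DecidableEq D] {P : (D → ℂ) → Prop} (v : D → ℂ) (hv : UnitVec v) (lam : ℝ)
    (hl : ∀ u, UnitVec u → P u → Complex.normSq (star v ⬝ᵥ u) ≤ lam) (s : ℝ) (hs : 0 ≤ s)
    (σ : Matrix D D ℂ) (hσ : Hull P σ)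
    (hτ : Hull P ((((1 + s)⁻¹ : ℝ) : ℂ) • (vecProj v + (s : ℂ) • σ))) :
    1 ≤ (1 + s) * lam := by
  obtain ⟨p, hp, hp0, -⟩ := hull_expv hσ v lam hl
  obtain ⟨q, hq, -, hql⟩ := hull_expv hτ v lam hl
  rw [expv_smul, expv_add, expv_smul, expv_vecProj, hp, (unitVec_iff v).1 hv] at hq
  have hq' : (1 + s)⁻¹ * (1 + s * p) = q := by
    simp only [map_one] at hq
    exact_mod_cast hq
  have : 1 + s * p = (1 + s) * q := by rw [← hq']; field_simp
  nlinarith [mul_nonneg hs hp0]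

lemma isCPTP_of_fintype [DecidableEq D] {κ : Type*} [Fintype κ]
    (Λ : Matrix D D ℂ → Matrix D D ℂ) (K : κ → Matrix D D ℂ)
    (h : ∀ ρ, Λ ρ = ∑ i, K i * ρ * (K i)ᴴ) (h1 : ∑ i, (K i)ᴴ * K i = 1) : IsCPTP Λ := by
  let e := (Fintype.equivFin κ).symm
  refine ⟨Fintype.card κ, fun k => K (e k), fun ρ => ?_, ?_⟩
  · rw [h]; exact (Equiv.sum_comp e (fun i => K i * ρ * (K i)ᴴ)).symm
  · rw [← h1]; exact Equiv.sum_comp e (fun i => (K i)ᴴ * K i)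

lemma sandwich (x y : D → ℂ) (ρ : Matrix D D ℂ) :
    vecMulVec x (star y) * ρ * (vecMulVec x (star y))ᴴ = expv y ρ • vecProj x := by
  rw [vecProj_eq, conjTranspose_vecMulVec, star_star, vecMulVec_mul, vecMulVec_mul_vecMulVec,
    expv, dotProduct_mulVec, vecMulVec_smul]

lemma kraus_sq (x y : D → ℂ) (hx : UnitVec x) :
    (vecMulVec x (star y))ᴴ * vecMulVec x (star y) = vecProj y := by
  rw [conjTranspose_vecMulVec, star_star, vecMulVec_mul_vecMulVec, (unitVec_iff x).1 hx,
    one_smul, vecProj_eq]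

lemma measure_prepare [DecidableEq D] {P : (D → ℂ) → Prop} (v₁ v₂ : D → ℂ) (hv₁ : UnitVec v₁)
    (hv₂ : UnitVec v₂) (σ : Matrix D D ℂ) (hσ : Hull P σ) :
    IsCPTP (fun ρ => expv v₁ ρ • vecProj v₂ + (ρ.trace - expv v₁ ρ) • σ) := by
  obtain ⟨m, w, u, hw, h1, hu, rfl⟩ := hσ
  have h1' : ∑ k, (w k : ℂ) = 1 := by exact_mod_cast h1
  have hsq : ∀ k, ((Real.sqrt (w k) : ℝ) : ℂ) * ((Real.sqrt (w k) : ℝ) : ℂ) = w k := by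
    intro k; rw [← Complex.ofReal_mul, Real.mul_self_sqrt (hw k)]
  set Q : Matrix D D ℂ := 1 - vecProj v₁ with hQ
  have hPH : (vecProj v₁)ᴴ = vecProj v₁ := (posSemidef_vecProj v₁).1
  have hPP : vecProj v₁ * vecProj v₁ = vecProj v₁ := by
    rw [vecProj_eq, vecMulVec_mul_vecMulVec, (unitVec_iff _).1 hv₁, one_smul]
  have hQH : Qᴴ = Q := by rw [hQ, conjTranspose_sub, hPH, conjTranspose_one]
  have hQQ : Q * Q = Q := by rw [hQ, Matrix.sub_mul, Matrix.mul_sub, Matrix.mul_sub, hPP]; simp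
  have hPtr : ∀ ρ : Matrix D D ℂ, (vecProj v₁ * ρ).trace = expv v₁ ρ := by
    intro ρ
    rw [vecProj_eq, vecMulVec_mul, trace_vecMulVec, expv, dotProduct_mulVec, dotProduct_comm]
  -- columns of `Q`
  have hsum1 : ∀ ρ : Matrix D D ℂ, ∑ j, expv (fun i => Q i j) ρ = ρ.trace - expv v₁ ρ := by
    intro ρ
    have : ∑ j, expv (fun i => Q i j) ρ = (Qᴴ * ρ * Q).trace := by
      rw [Matrix.mul_assoc]
      simp only [Matrix.trace, expv, diag_apply, Matrix.mul_apply, dotProduct, mulVec, 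
        conjTranspose_apply, Pi.star_apply]
    rw [this, hQH, Matrix.trace_mul_comm, ← Matrix.mul_assoc, hQQ, hQ, Matrix.sub_mul,
      Matrix.one_mul, trace_sub, hPtr]
  have hsum2 : ∑ j, vecProj (fun i => Q i j) = Q := by
    conv_rhs => rw [← hQQ]
    nth_rewrite 3 [← hQH]
    ext a b
    simp [Matrix.sum_apply, vecProj, Matrix.mul_apply]
  refine isCPTP_of_fintype (κ := Unit ⊕ (Fin m × D)) _
    (Sum.elim (fun _ => vecMulVec v₂ (star v₁))
      (fun kj => ((Real.sqrt (w kj.1) : ℝ) : ℂ) • vecMulVec (u kj.1) (star fun i => Q i kj.2)))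
    ?_ ?_
  · intro ρ
    simp only [Fintype.sum_sum_type, Sum.elim_inl, Sum.elim_inr, Finset.univ_unique,
      Finset.sum_singleton, sandwich, conjTranspose_smul, Matrix.smul_mul, Matrix.mul_smul,
      smul_smul, Fintype.sum_prod_type]
    congr 1
    rw [Finset.smul_sum]
    refine Finset.sum_congr rfl fun k _ => ?_
    simp only [RCLike.star_def, Complex.conj_ofReal, ← Finset.sum_smul, ← Finset.mul_sum, hsum1]
    rw [smul_smul]
    congr 1
    rw [← hsq k]; ring
  · simp only [Fintype.sum_sum_type, Sum.elim_inl, Sum.elim_inr, Finset.univ_unique,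
      Finset.sum_singleton, kraus_sq _ _ hv₂, kraus_sq _ _ (hu _).1, conjTranspose_smul,
      Matrix.smul_mul, Matrix.mul_smul, smul_smul, Fintype.sum_prod_type]
    simp only [RCLike.star_def, Complex.conj_ofReal, hsq, ← Finset.smul_sum, hsum2,
      ← Finset.sum_smul, h1', one_smul]
    simp [hQ]

lemma preserves [DecidableEq D] {P : (D → ℂ) → Prop} (v₁ v₂ : D → ℂ)
    (σ : Matrix D D ℂ) (hσ : Hull P σ) (hv₂ : UnitVec v₂) (lam s : ℝ) (hs : 0 ≤ s)
    (hl : ∀ u, UnitVec u → P u → Complex.normSq (star v₁ ⬝ᵥ u) ≤ lam)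
    (hτ : Hull P ((((1 + s)⁻¹ : ℝ) : ℂ) • (vecProj v₂ + (s : ℂ) • σ)))
    (hle : (1 + s) * lam ≤ 1) :
    PreservesSet (fun ρ => expv v₁ ρ • vecProj v₂ + (ρ.trace - expv v₁ ρ) • σ)
      {ρ | Hull P ρ} := by
  intro η _ hη _
  obtain ⟨p, hp, hp0, hpl⟩ := hull_expv hη v₁ lam hl
  have htr : η.trace = 1 := (hull_isState hη).2
  have htr' : (expv v₁ η • vecProj v₂ + (η.trace - expv v₁ η) • σ).trace = 1 := by
    rw [trace_add, trace_smul, trace_smul, trace_vecProj _ hv₂, (hull_isState hσ).2, htr]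
    simp
  simp only [htr', inv_one, one_smul, Set.mem_ofPred_eq]
  have := hull_convex hτ hσ (p * (1 + s)) (1 - p * (1 + s)) (by positivity)
    (by nlinarith) (by ring)
  convert this using 1
  rw [htr, hp, smul_smul, smul_add, smul_smul, add_assoc, ← add_smul]
  have h1s : (1 + (s : ℂ)) ≠ 0 := by
    have : (1 + s) ≠ 0 := by positivity
    exact_mod_cast this
  congr 2
  · push_cast; field_simp
  · push_cast; field_simp; ring

end gen

section closedness
variable {n d : ℕ}

lemma prodVec_swap {v : (Fin n → Fin d) → ℂ} (h : IsProdVec (Idx := fun _ : Fin n => Fin d) v)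
    (i : Fin n) (f g : Fin n → Fin d) :
    v f * v g = v (Function.update f i (g i)) * v (Function.update g i (f i)) := by
  obtain ⟨ψ, hψ⟩ := h
  rw [hψ f, hψ g, hψ (Function.update f i (g i)), hψ (Function.update g i (f i)),
    ← Finset.prod_mul_distrib, ← Finset.prod_mul_distrib]
  refine Finset.prod_congr rfl fun j _ => ?_
  by_cases hj : j = i
  · subst hj; simp [mul_comm]
  · simp [hj]

lemma prodVec_of_swap {v : (Fin n → Fin d) → ℂ} (f0 : Fin n → Fin d) (h0 : v f0 ≠ 0)
    (hn : 0 < n)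
    (h : ∀ (i : Fin n) (f g : Fin n → Fin d),
      v f * v g = v (Function.update f i (g i)) * v (Function.update g i (f i))) :
    IsProdVec (Idx := fun _ : Fin n => Fin d) v := by
  have key : ∀ (f : Fin n → Fin d) (s : Finset (Fin n)), v (s.piecewise f f0)
      = v f0 * ∏ i ∈ s, (v (Function.update f0 i (f i)) / v f0) := by
    intro f s
    induction s using Finset.induction_on with
    | empty => simp
    | insert i s hi ih =>
      have := h i ((insert i s).piecewise f f0) f0
      have e1 : Function.update ((insert i s).piecewise f f0) i (f0 i) = s.piecewise f f0 := by
        ext j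
        by_cases hj : j = i
        · subst hj; simp [hi]
        · simp [hj, Finset.piecewise]
      have e2 : (insert i s).piecewise f f0 i = f i := by simp
      rw [e1, e2, ih] at this
      rw [Finset.prod_insert hi]
      refine mul_right_cancel₀ h0 ?_
      rw [this]
      field_simp
  let i0 : Fin n := ⟨0, hn⟩
  refine ⟨fun i x => (if i = i0 then v f0 else 1) * (v (Function.update f0 i x) / v f0),
    fun f => ?_⟩
  have := key f Finset.univ
  rw [Finset.piecewise_univ] at this
  rw [this, Finset.prod_mul_distrib]
  simp

lemma unitVec_ne {D : Type*} [Fintype D] {v : D → ℂ} (h : UnitVec v) : ∃ f, v f ≠ 0 := by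
  by_contra hc
  push Not at hc
  simp [UnitVec, hc] at h

lemma closed_unit {D : Type*} [Fintype D] : IsClosed {u : D → ℂ | UnitVec u} :=
  isCompact_unit.isClosed

lemma closed_prod (hn : 0 < n) : IsClosed {u : (Fin n → Fin d) → ℂ |
    UnitVec u ∧ IsProdVec (Idx := fun _ : Fin n => Fin d) u} := by
  have : {u : (Fin n → Fin d) → ℂ | UnitVec u ∧ IsProdVec (Idx := fun _ : Fin n => Fin d) u}
      = {u | UnitVec u} ∩ ⋂ (i : Fin n) (f : Fin n → Fin d) (g : Fin n → Fin d),
        {u | u f * u g = u (Function.update f i (g i)) * u (Function.update g i (f i))} := by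
    ext u
    simp only [Set.mem_ofPred_eq, Set.mem_inter_iff, Set.mem_iInter]
    refine and_congr_right fun hu => ⟨fun h i f g => prodVec_swap h i f g, fun h => ?_⟩
    obtain ⟨f0, h0⟩ := unitVec_ne hu
    exact prodVec_of_swap f0 h0 hn h
  rw [this]
  refine closed_unit.inter (isClosed_iInter fun i => isClosed_iInter fun f =>
    isClosed_iInter fun g => isClosed_eq (by fun_prop) (by fun_prop))

/-- The vector `v` factorises across `M`. -/
def Splits (M : Finset (Fin n)) (v : (Fin n → Fin d) → ℂ) : Prop :=
  ∀ f g : Fin n → Fin d, v f * v g = v (M.piecewise f g) * v (M.piecewise g f)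

lemma splits_of {M : Finset (Fin n)} {v : (Fin n → Fin d) → ℂ}
    (a : ((j : {j : Fin n // j ∈ M}) → Fin d) → ℂ)
    (b : ((j : {j : Fin n // j ∉ M}) → Fin d) → ℂ)
    (h : ∀ f, v f = a (fun j => f j.1) * b (fun j => f j.1)) : Splits M v := by
  intro f g
  have h1 : ∀ x y : Fin n → Fin d, (fun j : {j : Fin n // j ∈ M} => M.piecewise x y j.1)
      = fun j => x j.1 := by
    intro x y; ext j; simp [j.2]
  have h2 : ∀ x y : Fin n → Fin d, (fun j : {j : Fin n // j ∉ M} => M.piecewise x y j.1)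
      = fun j => y j.1 := by
    intro x y; ext j; simp [j.2]
  rw [h f, h g, h (M.piecewise f g), h (M.piecewise g f), h1, h1, h2, h2]
  ring

lemma of_splits {M : Finset (Fin n)} {v : (Fin n → Fin d) → ℂ} (f0 : Fin n → Fin d)
    (h0 : v f0 ≠ 0) (h : Splits M v) :
    ∃ (a : ((j : {j : Fin n // j ∈ M}) → Fin d) → ℂ)
      (b : ((j : {j : Fin n // j ∉ M}) → Fin d) → ℂ),
      ∀ f, v f = a (fun j => f j.1) * b (fun j => f j.1) := by
  refine ⟨fun x => v (fun j => if hj : j ∈ M then x ⟨j, hj⟩ else f0 j),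
    fun y => v (fun j => if hj : j ∉ M then y ⟨j, hj⟩ else f0 j) / v f0, fun f => ?_⟩
  have := h f f0
  have e1 : (fun j => if hj : j ∈ M then f j else f0 j) = M.piecewise f f0 := by
    ext j; simp [Finset.piecewise]
  have e2 : (fun j => if hj : j ∉ M then f j else f0 j) = M.piecewise f0 f := by
    ext j; by_cases hj : j ∈ M <;> simp [Finset.piecewise, hj]
  simp only [e1, e2]
  field_simp
  exact this

lemma closed_bisep : IsClosed {u : (Fin n → Fin d) → ℂ |
    UnitVec u ∧ IsBisepVec (Idx := fun _ : Fin n => Fin d) u} := by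
  have : {u : (Fin n → Fin d) → ℂ | UnitVec u ∧ IsBisepVec (Idx := fun _ : Fin n => Fin d) u}
      = {u | UnitVec u} ∩ ⋃ M ∈ {M : Finset (Fin n) | M.Nonempty ∧ M ≠ Finset.univ},
        {u | Splits M u} := by
    ext u
    simp only [Set.mem_ofPred_eq, Set.mem_inter_iff, Set.mem_iUnion]
    refine and_congr_right fun hu => ⟨?_, ?_⟩
    · rintro ⟨M, h1, h2, a, b, hab⟩
      exact ⟨M, ⟨h1, h2⟩, splits_of a b hab⟩
    · rintro ⟨M, ⟨h1, h2⟩, h⟩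
      obtain ⟨f0, h0⟩ := unitVec_ne hu
      exact ⟨M, h1, h2, of_splits f0 h0 h⟩
  rw [this]
  refine closed_unit.inter (Set.Finite.isClosed_biUnion (Set.toFinite _) fun M _ => ?_)
  have : {u : (Fin n → Fin d) → ℂ | Splits M u} = ⋂ (f : Fin n → Fin d) (g : Fin n → Fin d),
        {u | u f * u g = u (M.piecewise f g) * u (M.piecewise g f)} := by
    ext u; simp [Splits]
  rw [this]
  exact isClosed_iInter fun f => isClosed_iInter fun g =>
    isClosed_eq (by fun_prop) (by fun_prop)

lemma prod_bisep (hn : 2 ≤ n) {v : (Fin n → Fin d) → ℂ} (hv : UnitVec v)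
    (h : IsProdVec (Idx := fun _ : Fin n => Fin d) v) :
    IsBisepVec (Idx := fun _ : Fin n => Fin d) v := by
  obtain ⟨f0, h0⟩ := unitVec_ne hv
  refine ⟨{⟨0, by omega⟩}, by simp, ?_, of_splits f0 h0 ?_⟩
  · intro hc
    have : (⟨1, by omega⟩ : Fin n) ∈ ({⟨0, by omega⟩} : Finset (Fin n)) := by rw [hc]; simp
    simp at this
  · intro f g
    rw [prodVec_swap h ⟨0, by omega⟩ f g, Finset.piecewise_singleton, Finset.piecewise_singleton,
      mul_comm]

end closedness

section ghz
variable {n e : ℕ}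

/-- The single-party vector `(|0⟩ + z|1⟩)/√2`. -/
def phi (z : ℂ) (x : Fin (e + 2)) : ℂ :=
  if x = 0 then ((Real.sqrt 2)⁻¹ : ℝ) else if x = 1 then ((Real.sqrt 2)⁻¹ : ℝ) * z else 0

/-- The product vector `⊗ (|0⟩ + z|1⟩)/√2`. -/
def uvec (z : ℂ) (f : Fin n → Fin (e + 2)) : ℂ := ∏ i, phi z (f i)

/-- The vector `a|0…0⟩ + b|1…1⟩`. -/
def ghz (a b : ℝ) (f : Fin n → Fin (e + 2)) : ℂ := if f = 0 then a else if f = 1 then b else 0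

lemma unit_prod (ψ : Fin n → Fin (e + 2) → ℂ) (h : ∀ i, UnitVec (ψ i)) :
    UnitVec (fun f : Fin n → Fin (e + 2) => ∏ i, ψ i (f i)) := by
  have := Finset.prod_univ_sum (fun _ : Fin n => (Finset.univ : Finset (Fin (e + 2))))
    (fun i x => star (ψ i x) * ψ i x)
  rw [Fintype.piFinset_univ] at this
  simp only [UnitVec] at h ⊢
  simp only [h, Finset.prod_const_one] at this
  rw [this]
  refine Finset.sum_congr rfl fun f _ => ?_
  rw [Finset.prod_mul_distrib, star_prod]

lemma sqrt2c : (((Real.sqrt 2)⁻¹ : ℝ) : ℂ) * (((Real.sqrt 2)⁻¹ : ℝ) : ℂ) = 1 / 2 := by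
  rw [← Complex.ofReal_mul, ← mul_inv, Real.mul_self_sqrt (by norm_num)]
  norm_num

lemma unit_phi (z : ℂ) (hz : star z * z = 1) : UnitVec (phi z : Fin (e + 2) → ℂ) := by
  rw [UnitVec, Fin.sum_univ_succ, Fin.sum_univ_succ]
  have h3 : ∀ i : Fin e, phi z i.succ.succ = 0 := by
    intro i
    have h0 : i.succ.succ ≠ 0 := Fin.succ_ne_zero _
    have h1 : i.succ.succ ≠ 1 := by
      rw [← Fin.succ_zero_eq_one]
      intro h
      exact Fin.succ_ne_zero _ (Fin.succ_injective _ h)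
    simp only [phi, h0, h1, if_false]
  simp only [h3, mul_zero, Finset.sum_const_zero, add_zero, Fin.succ_zero_eq_one]
  have e0 : phi z (0 : Fin (e + 2)) = ((Real.sqrt 2)⁻¹ : ℝ) := by simp [phi]
  have e1 : phi z (1 : Fin (e + 2)) = ((Real.sqrt 2)⁻¹ : ℝ) * z := by simp [phi]
  rw [e0, e1]
  simp only [star_mul', RCLike.star_def, Complex.conj_ofReal] at hz ⊢
  linear_combination (1 + starRingEnd ℂ z * z) * sqrt2c + (1 / 2) * hz

lemma uvec_unit (z : ℂ) (hz : star z * z = 1) :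
    UnitVec (uvec z : (Fin n → Fin (e + 2)) → ℂ) :=
  unit_prod (fun _ => phi z) fun _ => unit_phi z hz

lemma uvec_prod (z : ℂ) :
    IsProdVec (Idx := fun _ : Fin n => Fin (e + 2)) (uvec z) := ⟨fun _ => phi z, fun _ => rfl⟩

/-- Number of ones. -/
def cnt (f : Fin n → Fin (e + 2)) : ℕ := ∑ i, if f i = 1 then 1 else 0

lemma cnt_le (f : Fin n → Fin (e + 2)) : cnt f ≤ n := by
  calc cnt f ≤ ∑ _i : Fin n, 1 := Finset.sum_le_sum fun i _ => by split_ifs <;> simp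
    _ = n := by simp

lemma cnt_eq_n {f : Fin n → Fin (e + 2)} (h : cnt f = n) : f = 1 := by
  by_contra hc
  obtain ⟨i, hi⟩ := Function.ne_iff.1 hc
  have : cnt f < ∑ _i : Fin n, 1 := Finset.sum_lt_sum
    (fun i _ => by split_ifs <;> simp) ⟨i, Finset.mem_univ i, by simp at hi; simp [hi]⟩
  simp at this
  omega

lemma cnt_eq_zero {f : Fin n → Fin (e + 2)} (h : cnt f = 0) (h2 : ∀ i, f i = 0 ∨ f i = 1) :
    f = 0 := by
  ext1 i
  rcases h2 i with h' | h'
  · simpa using h'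
  · have := (Finset.sum_eq_zero_iff.1 h) i (Finset.mem_univ i)
    simp [h'] at this

lemma uvec_eq (z : ℂ) (f : Fin n → Fin (e + 2)) (h2 : ∀ i, f i = 0 ∨ f i = 1) :
    uvec z f = (((Real.sqrt 2)⁻¹ : ℝ) : ℂ) ^ n * z ^ cnt f := by
  have : ∀ i, phi z (f i) = (((Real.sqrt 2)⁻¹ : ℝ) : ℂ) * z ^ (if f i = 1 then 1 else 0) := by
    intro i
    rcases h2 i with h | h <;> simp [phi, h]
  rw [uvec, Finset.prod_congr rfl fun i _ => this i, Finset.prod_mul_distrib,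
    Finset.prod_pow_eq_pow_sum]
  simp [cnt]

lemma uvec_eq_zero (z : ℂ) (f : Fin n → Fin (e + 2)) (h2 : ¬ ∀ i, f i = 0 ∨ f i = 1) :
    uvec z f = 0 := by
  push Not at h2
  obtain ⟨i, h0, h1⟩ := h2
  exact Finset.prod_eq_zero (Finset.mem_univ i) (by simp [phi, h0, h1])

/-- The primitive `2n`-th root of unity. -/
def om (n : ℕ) : ℂ := Complex.exp (Real.pi * Complex.I / n)

lemma om_star (n : ℕ) : star (om n) * om n = 1 := by
  rw [om, RCLike.star_def, ← Complex.exp_conj, ← Complex.exp_add]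
  simp only [map_div₀, map_mul, Complex.conj_ofReal, Complex.conj_I, Complex.conj_natCast]
  rw [← Complex.exp_zero]; congr 1; ring

lemma om_star_pow (n k : ℕ) : star (om n ^ k) * om n ^ k = 1 := by
  rw [star_pow, ← mul_pow, om_star, one_pow]

lemma om_pow (hn : 0 < n) : om n ^ n = -1 := by
  rw [om, ← Complex.exp_nat_mul, mul_div_cancel₀ _ (by exact_mod_cast hn.ne'),
    Complex.exp_pi_mul_I]

lemma star_om_pow (hn : 0 < n) : star (om n) ^ n = -1 := by
  rw [← star_pow, om_pow hn]; simp

lemma om_neg_one (hn : 0 < n) (p q : ℕ) (hp : p ≤ n) (hq : q ≤ n)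
    (h : om n ^ p * star (om n) ^ q = -1) : (p = n ∧ q = 0) ∨ (p = 0 ∧ q = n) := by
  have hn' : (n : ℂ) ≠ 0 := by exact_mod_cast hn.ne'
  have h1 : om n ^ p = - om n ^ q := by
    have := congrArg (· * om n ^ q) h
    simp only [mul_assoc, ← mul_pow, om_star, one_pow, mul_one] at this
    rw [this]; ring
  have h2 : om n ^ p = om n ^ (q + n) := by rw [h1, pow_add, om_pow hn]; ring
  simp only [om, ← Complex.exp_nat_mul] at h2
  rw [Complex.exp_eq_exp_iff_exists_int] at h2
  obtain ⟨t, ht⟩ := h2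
  have hpi : (Real.pi : ℂ) * Complex.I ≠ 0 := by
    simp [Real.pi_ne_zero]
  have ht2 : (p : ℂ) = q + n + 2 * t * n := by
    push_cast at ht
    field_simp at ht
    linear_combination ht
  have ht3 : (p : ℤ) = q + n + 2 * t * n := by exact_mod_cast ht2
  have hn1 : (0 : ℤ) < n := by exact_mod_cast hn
  have hp1 : (p : ℤ) ≤ n := by exact_mod_cast hp
  have hq1 : (q : ℤ) ≤ n := by exact_mod_cast hq
  have hlo : -1 ≤ t := by
    by_contra hc
    have : t ≤ -2 := by omega
    nlinarith
  have hhi : t ≤ 0 := by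
    by_contra hc
    have : 1 ≤ t := by omega
    nlinarith
  have : t = -1 ∨ t = 0 := by omega
  rcases this with rfl | rfl
  · right; omega
  · left; omega

lemma geom_key (hn : 0 < n) (z : ℂ) (hz : z ^ (2 * n) = 1) :
    ∑ j : Fin n, (z ^ (2 * (j : ℕ)) - z ^ (2 * (j : ℕ) + 1)) = if z = -1 then 2 * (n : ℂ) else 0 := by
  have : ∀ j : Fin n, z ^ (2 * (j : ℕ)) - z ^ (2 * (j : ℕ) + 1) = (1 - z) * (z ^ 2) ^ (j : ℕ) := by
    intro j; rw [← pow_mul]; ring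
  rw [Finset.sum_congr rfl fun j _ => this j, ← Finset.mul_sum,
    Fin.sum_univ_eq_sum_range (fun j => (z ^ 2) ^ j)]
  split_ifs with h
  · subst h; norm_num
  · by_cases h1 : z = 1
    · simp [h1]
    · have h2 : z ^ 2 ≠ 1 := by
        intro h3
        rcases mul_eq_zero.1 (show (z - 1) * (z + 1) = 0 by linear_combination h3) with h4 | h4
        · exact h1 (sub_eq_zero.1 h4)
        · exact h (eq_neg_of_add_eq_zero_left h4)
      rw [geom_sum_eq h2, ← pow_mul, hz]
      simp

/-- Separable combination with even (`c = 0`) or odd (`c = 1`) phases. -/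
def sig (n e c : ℕ) : Matrix (Fin n → Fin (e + 2)) (Fin n → Fin (e + 2)) ℂ :=
  ∑ j : Fin n, (((n : ℝ)⁻¹ : ℝ) : ℂ) • vecProj (uvec (om n ^ (2 * (j : ℕ) + c)))

lemma sig_hull {P : ((Fin n → Fin (e + 2)) → ℂ) → Prop} (hn : 0 < n)
    (hP : ∀ u, UnitVec u → IsProdVec (Idx := fun _ : Fin n => Fin (e + 2)) u → P u) (c : ℕ) :
    Hull P (sig n e c) := by
  refine hull_of_fintype (fun _ : Fin n => (n : ℝ)⁻¹)
    (fun j => uvec (om n ^ (2 * (j : ℕ) + c))) (fun _ => by positivity) ?_ ?_ rfl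
  · have : (n : ℝ) ≠ 0 := by exact_mod_cast hn.ne'
    simp [this]
  · intro k
    have := uvec_unit (n := n) (e := e) _ (om_star_pow n (2 * (k : ℕ) + c))
    exact ⟨this, hP _ this (uvec_prod _)⟩

lemma sig_diff (hn : 0 < n) (f g : Fin n → Fin (e + 2)) :
    sig n e 0 f g - sig n e 1 f g
      = if (f = 1 ∧ g = 0) ∨ (f = 0 ∧ g = 1) then 2 * (1 / 2 : ℂ) ^ n else 0 := by
  have hn' : (n : ℂ) ≠ 0 := by exact_mod_cast hn.ne'
  have hc : ∀ c, sig n e c f g = ∑ j : Fin n, (n : ℂ)⁻¹ *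
      (uvec (om n ^ (2 * (j : ℕ) + c)) f * star (uvec (om n ^ (2 * (j : ℕ) + c)) g)) := by
    intro c
    simp only [sig, Matrix.sum_apply, Matrix.smul_apply, vecProj, Matrix.of_apply, smul_eq_mul]
    push_cast
    rfl
  rw [hc, hc, ← Finset.sum_sub_distrib]
  by_cases hf : ∀ i, f i = 0 ∨ f i = 1
  · by_cases hg : ∀ i, g i = 0 ∨ g i = 1
    · set z := om n ^ cnt f * star (om n) ^ cnt g with hz
      have hterm : ∀ k : ℕ, uvec (om n ^ k) f * star (uvec (om n ^ k) g)
          = (1 / 2 : ℂ) ^ n * z ^ k := by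
        intro k
        rw [uvec_eq _ _ hf, uvec_eq _ _ hg, ← sqrt2c, hz]
        simp only [star_mul', star_pow, RCLike.star_def, Complex.conj_ofReal]
        ring
      have hz2 : z ^ (2 * n) = 1 := by
        have h1 := om_pow hn
        have h2 := star_om_pow hn
        have : z ^ (2 * n) = ((om n ^ n) ^ cnt f * (star (om n) ^ n) ^ cnt g) ^ 2 := by
          rw [hz]; ring
        rw [this, h1, h2, mul_pow, ← pow_mul, ← pow_mul, mul_comm _ 2, mul_comm _ 2, pow_mul,
          pow_mul]
        simp
      have hsum := geom_key hn z hz2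
      have : ∀ j : Fin n, (n : ℂ)⁻¹ * (uvec (om n ^ (2 * (j : ℕ) + 0)) f *
            star (uvec (om n ^ (2 * (j : ℕ) + 0)) g)) -
          (n : ℂ)⁻¹ * (uvec (om n ^ (2 * (j : ℕ) + 1)) f *
            star (uvec (om n ^ (2 * (j : ℕ) + 1)) g))
          = (n : ℂ)⁻¹ * (1 / 2 : ℂ) ^ n * (z ^ (2 * (j : ℕ)) - z ^ (2 * (j : ℕ) + 1)) := by
        intro j
        rw [hterm, hterm]; simp only [add_zero]; ring
      rw [Finset.sum_congr rfl fun j _ => this j, ← Finset.mul_sum, hsum]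
      have hiff : z = -1 ↔ (f = 1 ∧ g = 0) ∨ (f = 0 ∧ g = 1) := by
        have c1 : cnt (1 : Fin n → Fin (e + 2)) = n := by simp [cnt]
        have c0 : cnt (0 : Fin n → Fin (e + 2)) = 0 := by simp [cnt]
        constructor
        · intro h
          rcases om_neg_one hn _ _ (cnt_le f) (cnt_le g) h with ⟨h1, h2⟩ | ⟨h1, h2⟩
          · exact Or.inl ⟨cnt_eq_n h1, cnt_eq_zero h2 hg⟩
          · exact Or.inr ⟨cnt_eq_zero h1 hf, cnt_eq_n h2⟩
        · rintro (⟨rfl, rfl⟩ | ⟨rfl, rfl⟩)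
          · rw [hz, c1, c0, om_pow hn]; simp
          · rw [hz, c1, c0, star_om_pow hn]; simp
      simp only [hiff]
      split_ifs
      · field_simp
      · simp
    · rw [if_neg]
      · simp [uvec_eq_zero _ g hg]
      · rintro (⟨rfl, rfl⟩ | ⟨rfl, rfl⟩) <;> exact hg (by simp)
  · rw [if_neg]
    · simp [uvec_eq_zero _ f hf]
    · rintro (⟨rfl, rfl⟩ | ⟨rfl, rfl⟩) <;> exact hf (by simp)

lemma zero_ne_one_fun (hn : 0 < n) : (0 : Fin n → Fin (e + 2)) ≠ 1 := by
  intro h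
  have := congrFun h ⟨0, hn⟩
  simp at this

lemma ghz_decomp (hn : 0 < n) (a b : ℝ) :
    vecProj (ghz a b : (Fin n → Fin (e + 2)) → ℂ)
      + ((a * b * 2 ^ n / 2 : ℝ) : ℂ) • sig n e 1
    = ((a ^ 2 : ℝ) : ℂ) • vecProj (ghz 1 0) + ((b ^ 2 : ℝ) : ℂ) • vecProj (ghz 0 1)
      + ((a * b * 2 ^ n / 2 : ℝ) : ℂ) • sig n e 0 := by
  ext f g
  have := sig_diff (e := e) hn f g
  have h01 := zero_ne_one_fun (e := e) hn
  have h2 : ((2 : ℂ) ^ n) * (1 / 2 : ℂ) ^ n = 1 := by rw [← mul_pow]; norm_num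
  rw [sub_eq_iff_eq_add] at this
  simp only [Matrix.add_apply, Matrix.smul_apply, smul_eq_mul, this, vecProj, Matrix.of_apply, ghz]
  rw [mul_add]
  have h3 : ((a * b * 2 ^ n / 2 : ℝ) : ℂ) * (2 * (1 / 2 : ℂ) ^ n) = a * b := by
    push_cast
    linear_combination (a : ℂ) * b * h2
  rw [mul_ite, h3]
  by_cases f0 : f = 0
  · by_cases g0 : g = 0
    · simp [f0, g0, h01]; ring
    · by_cases g1 : g = 1
      · simp [f0, g1, h01, h01.symm]
      · simp [f0, g0, g1, h01]
  · by_cases f1 : f = 1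
    · by_cases g0 : g = 0
      · simp [f1, g0, h01, h01.symm]; ring
      · by_cases g1 : g = 1
        · simp [f1, g1, h01, h01.symm]; ring
        · simp [f1, g0, g1, h01, h01.symm]
    · simp [f0, f1]

lemma ghz_unit (hn : 0 < n) (a b : ℝ) (h : a ^ 2 + b ^ 2 = 1) :
    UnitVec (ghz a b : (Fin n → Fin (e + 2)) → ℂ) := by
  have h01 := zero_ne_one_fun (e := e) hn
  have : ∀ f : Fin n → Fin (e + 2), star (ghz a b f) * ghz a b f
      = (if f = 0 then (a : ℂ) ^ 2 else 0) + (if f = 1 then (b : ℂ) ^ 2 else 0) := by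
    intro f
    by_cases f0 : f = 0
    · simp [ghz, f0, h01]; ring
    · by_cases f1 : f = 1
      · simp [ghz, f1, h01.symm]; ring
      · simp [ghz, f0, f1]
  rw [UnitVec, Finset.sum_congr rfl fun f _ => this f, Finset.sum_add_distrib]
  simp only [Finset.sum_ite_eq', Finset.mem_univ, if_true]
  exact_mod_cast h

lemma basis_prod (y : Fin (e + 2)) : IsProdVec (Idx := fun _ : Fin n => Fin (e + 2))
    (fun f => if f = (fun _ => y) then (1 : ℂ) else 0) := by
  refine ⟨fun _ x => if x = y then 1 else 0, fun f => ?_⟩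
  by_cases h : f = fun _ => y
  · simp [h]
  · obtain ⟨i, hi⟩ := Function.ne_iff.1 h
    refine (if_neg h).trans (Finset.prod_eq_zero (Finset.mem_univ i) ?_).symm
    simp [hi]

lemma ghz10_prod : IsProdVec (Idx := fun _ : Fin n => Fin (e + 2)) (ghz 1 0) := by
  convert basis_prod (n := n) (0 : Fin (e + 2)) using 1
  ext f
  simp only [ghz]
  have : (0 : Fin n → Fin (e + 2)) = fun _ => 0 := rfl
  rw [this]
  split_ifs <;> simp

lemma ghz01_prod (hn : 0 < n) : IsProdVec (Idx := fun _ : Fin n => Fin (e + 2)) (ghz 0 1) := by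
  convert basis_prod (n := n) (1 : Fin (e + 2)) using 1
  have h01 := zero_ne_one_fun (e := e) hn
  ext f
  simp only [ghz]
  have : (1 : Fin n → Fin (e + 2)) = fun _ => 1 := rfl
  rw [← this]
  by_cases f0 : f = 0
  · simp [f0, h01]
  · simp [f0]

lemma ghz_not_bisep (a b : ℝ) (ha : a ≠ 0) (hb : b ≠ 0) (c : ℂ)
    (u : (Fin n → Fin (e + 2)) → ℂ) (hu : UnitVec u)
    (h : IsBisepVec (Idx := fun _ : Fin n => Fin (e + 2)) u) : u ≠ c • ghz a b := by
  rintro rfl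
  obtain ⟨M, ⟨i, hi⟩, hM, x, y, hxy⟩ := h
  have hs := splits_of x y hxy 0 1
  obtain ⟨j, hj⟩ : ∃ j, j ∉ M := by
    by_contra hc
    push Not at hc
    exact hM (Finset.eq_univ_iff_forall.2 hc)
  have hc : c ≠ 0 := by
    rintro rfl
    obtain ⟨f, hf⟩ := unitVec_ne hu
    simp at hf
  have h01 := zero_ne_one_fun (n := n) (e := e) i.pos
  have n1 : M.piecewise (0 : Fin n → Fin (e + 2)) 1 ≠ 0 := fun h => by
    have := congrFun h j; simp [hj] at this
  have n2 : M.piecewise (0 : Fin n → Fin (e + 2)) 1 ≠ 1 := fun h => by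
    have := congrFun h i; simp [hi] at this
  simp [ghz, h01.symm, n1, n2, ha, hb, hc] at hs

end ghz

lemma main_aux (n e : ℕ) (hn : 2 ≤ n) (P : ((Fin n → Fin (e + 2)) → ℂ) → Prop)
    (hcl : IsClosed {u : (Fin n → Fin (e + 2)) → ℂ | UnitVec u ∧ P u})
    (hP1 : ∀ u, UnitVec u → IsProdVec (Idx := fun _ : Fin n => Fin (e + 2)) u → P u)
    (hP2 : ∀ u, UnitVec u → P u → IsBisepVec (Idx := fun _ : Fin n => Fin (e + 2)) u)
    (v₁ : (Fin n → Fin (e + 2)) → ℂ) (hv₁ : UnitVec v₁) (h₁ : ¬ Hull P (vecProj v₁)) :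
    ∃ v₂ : (Fin n → Fin (e + 2)) → ℂ, UnitVec v₂ ∧ ¬ Hull P (vecProj v₂) ∧
      Robustness {ρ | Hull P ρ} (vecProj v₂) ≠ Robustness {ρ | Hull P ρ} (vecProj v₁) ∧
      ∃ Λ : Matrix (Fin n → Fin (e + 2)) (Fin n → Fin (e + 2)) ℂ →
            Matrix (Fin n → Fin (e + 2)) (Fin n → Fin (e + 2)) ℂ,
        IsCPTP Λ ∧ PreservesSet Λ {ρ | Hull P ρ} ∧ Λ (vecProj v₁) = vecProj v₂ := by
  have hn0 : 0 < n := by omega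
  obtain ⟨lam, hl0, hl1, hl⟩ := gap hcl v₁ hv₁ (by
    rintro c u hu hPu rfl
    refine h₁ ?_
    have : vecProj v₁ = vecProj (c • v₁) := by
      have hc : star c * c = 1 := by
        rw [unitVec_iff] at hu hv₁
        rw [star_smul, smul_dotProduct, dotProduct_smul, hv₁] at hu
        simpa using hu
      ext i j
      simp only [vecProj, Matrix.of_apply, Pi.smul_apply, smul_eq_mul, star_mul']
      linear_combination (-(v₁ i * star (v₁ j))) * hc
    rw [this]
    exact hull_vec hu hPu)
  set ε := lam⁻¹ - 1 with hε
  have hε0 : 0 < ε := by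
    have := (one_lt_inv₀ hl0).2 hl1
    linarith
  set θ := min 1 (ε / 2 ^ n) with hθ
  have hθ0 : 0 < θ := by positivity
  have hθ1 : θ ≤ 1 := min_le_left _ _
  have hθ2 : θ * 2 ^ n ≤ ε := by
    have : θ ≤ ε / 2 ^ n := min_le_right _ _
    rwa [le_div_iff₀ (by positivity)] at this
  set a := Real.cos θ with ha
  set b := Real.sin θ with hb
  have ha0 : 0 < a := Real.cos_pos_of_mem_Ioo
    ⟨by linarith [Real.pi_gt_three], by linarith [Real.pi_gt_three]⟩
  have hb0 : 0 < b := Real.sin_pos_of_pos_of_lt_pi hθ0 (by linarith [Real.pi_gt_three])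
  have ha1 : a ≤ 1 := Real.cos_le_one θ
  have hbθ : b ≤ θ := Real.sin_le hθ0.le
  have hab : a ^ 2 + b ^ 2 = 1 := Real.cos_sq_add_sin_sq θ
  set s := a * b * 2 ^ n / 2 with hs
  have hs0 : 0 < s := by positivity
  have hsε : s < ε := by
    have h1 : a * b ≤ θ := by nlinarith
    have h2 : a * b * 2 ^ n ≤ θ * 2 ^ n := by gcongr
    have h3 : 0 < θ * 2 ^ n := by positivity
    linarith
  have hsl : (1 + s) * lam ≤ 1 := by
    have : (1 + s) ≤ lam⁻¹ := by linarith
    calc (1 + s) * lam ≤ lam⁻¹ * lam := by gcongr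
      _ = 1 := inv_mul_cancel₀ hl0.ne'
  have hv₂ : UnitVec (ghz a b : (Fin n → Fin (e + 2)) → ℂ) := ghz_unit hn0 a b hab
  obtain ⟨mu, hm0, hm1, hm⟩ := gap hcl (ghz a b) hv₂ (fun c u hu hPu =>
    ghz_not_bisep a b ha0.ne' hb0.ne' c u hu (hP2 u hu hPu))
  have hσ : Hull P (sig n e 1) := sig_hull hn0 hP1 1
  have hτ : Hull P ((((1 + s)⁻¹ : ℝ) : ℂ) • (vecProj (ghz a b) + (s : ℂ) • sig n e 1)) := by
    rw [ghz_decomp hn0 a b]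
    have u1 : UnitVec (ghz 1 0 : (Fin n → Fin (e + 2)) → ℂ) := ghz_unit hn0 1 0 (by norm_num)
    have u2 : UnitVec (ghz 0 1 : (Fin n → Fin (e + 2)) → ℂ) := ghz_unit hn0 0 1 (by norm_num)
    have A := hull_convex (hull_vec u1 (hP1 _ u1 ghz10_prod))
      (hull_vec u2 (hP1 _ u2 (ghz01_prod hn0))) (a ^ 2) (b ^ 2) (by positivity) (by positivity) hab
    have B := hull_convex A (sig_hull (e := e) hn0 hP1 0) (1 + s)⁻¹ ((1 + s)⁻¹ * s)
      (by positivity) (by positivity) (by field_simp)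
    convert B using 1
    rw [smul_add, smul_smul]
    rw [← hs, ← Complex.ofReal_mul]
  refine ⟨ghz a b, hv₂, ?_, ?_, _, measure_prepare v₁ _ hv₁ hv₂ _ hσ,
    preserves v₁ _ _ hσ hv₂ lam s hs0.le hl hτ hsl, ?_⟩
  · intro hc
    obtain ⟨p, hp, -, hpm⟩ := hull_expv hc _ mu hm
    rw [expv_vecProj, (unitVec_iff _).1 hv₂] at hp
    simp only [map_one] at hp
    have : (1 : ℝ) = p := by exact_mod_cast hp
    linarith
  · have hlow : mu⁻¹ - 1 ≤ Robustness {ρ | Hull P ρ} (vecProj (ghz a b)) := by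
      refine le_csInf ⟨s, hs0.le, _, hull_isState hσ, hσ, hτ⟩ ?_
      rintro t ⟨ht0, σ, -, hσ', hτ'⟩
      have := robust_lower _ hv₂ mu hm t ht0 σ hσ' hτ'
      have h2 : mu⁻¹ ≤ 1 + t := by rwa [inv_le_iff_one_le_mul₀ hm0]
      linarith
    have hpos : 0 < Robustness {ρ | Hull P ρ} (vecProj (ghz a b)) := by
      have := (one_lt_inv₀ hm0).2 hm1
      linarith
    have hup : Robustness {ρ | Hull P ρ} (vecProj (ghz a b)) ≤ s :=
      csInf_le ⟨0, fun t ht => ht.1⟩ ⟨hs0.le, _, hull_isState hσ, hσ, hτ⟩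
    by_cases hem : {s : ℝ | 0 ≤ s ∧ ∃ σ, IsState σ ∧ σ ∈ {ρ | Hull P ρ} ∧
        (((1 + s)⁻¹ : ℝ) : ℂ) • (vecProj v₁ + (s : ℂ) • σ) ∈ {ρ | Hull P ρ}}.Nonempty
    · have hlow1 : lam⁻¹ - 1 ≤ Robustness {ρ | Hull P ρ} (vecProj v₁) := by
        refine le_csInf hem ?_
        rintro t ⟨ht0, σ, -, hσ', hτ'⟩
        have := robust_lower _ hv₁ lam hl t ht0 σ hσ' hτ'
        have h2 : lam⁻¹ ≤ 1 + t := by rwa [inv_le_iff_one_le_mul₀ hl0]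
        linarith
      intro heq
      linarith
    · have : Robustness {ρ | Hull P ρ} (vecProj v₁) = 0 := by
        rw [Set.not_nonempty_iff_eq_empty] at hem
        rw [Robustness, hem, Real.sInf_empty]
      rw [this]
      exact hpos.ne'
  · simp [expv_vecProj, (unitVec_iff _).1 hv₁, trace_vecProj _ hv₁]

/-- **No isolation.** In a resource theory of entanglement where the free operations are
𝒳-preserving maps, no resource state is isolated: every pure state outside 𝒳 can be
deterministically converted to an inequivalent pure state outside 𝒳 (inequivalence is
witnessed by a different robustness). -/
theorem no_isolation (n d : ℕ) (hn : 2 ≤ n) (hd : 2 ≤ d)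
    (S : Set (Matrix (Fin n → Fin d) (Fin n → Fin d) ℂ))
    (hS : S = {ρ | FullySepState (fun _ : Fin n => Fin d) ρ} ∨
          S = {ρ | BisepState (fun _ : Fin n => Fin d) ρ})
    (v₁ : (Fin n → Fin d) → ℂ) (hv₁ : UnitVec v₁) (h₁ : vecProj v₁ ∉ S) :
    ∃ v₂ : (Fin n → Fin d) → ℂ, UnitVec v₂ ∧ vecProj v₂ ∉ S ∧
      Robustness S (vecProj v₂) ≠ Robustness S (vecProj v₁) ∧
      ∃ Λ : Matrix (Fin n → Fin d) (Fin n → Fin d) ℂ →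
            Matrix (Fin n → Fin d) (Fin n → Fin d) ℂ,
        IsCPTP Λ ∧ PreservesSet Λ S ∧ Λ (vecProj v₁) = vecProj v₂ := by
  obtain ⟨e, rfl⟩ : ∃ e, d = e + 2 := ⟨d - 2, by omega⟩
  rcases hS with rfl | rfl
  · exact main_aux n e hn (IsProdVec (Idx := fun _ : Fin n => Fin (e + 2)))
      (closed_prod (by omega)) (fun _ _ h => h) (fun u hu h => prod_bisep hn hu h) v₁ hv₁ h₁
  · exact main_aux n e hn (IsBisepVec (Idx := fun _ : Fin n => Fin (e + 2)))
      closed_bisep (fun u hu h => prod_bisep hn hu h) (fun _ _ h => h) v₁ hv₁ h₁
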